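/- arXiv:2510.11475 — 5 statements merged into one kernel-verified Lean document; each statement's English description precedes it below -/
import Mathlib

section
/- Let V be a real Hilbert space, let T : V → V be a continuous symmetric positive semidefinite linear map, let E : V → ℝ be Fréchet differentiable, and let M > 0, α ≥ 0, β ≥ 0 be real constants. Let φ : ℝ → V be differentiable with ψ := φ' also differentiable, and suppose that for every t one has −(α/M)·T(ψ'(t)) − (β/M)·T(ψ(t)) = ∇E(φ(t)), where ∇E(φ(t)) ∈ V is the gradient of E at φ(t), i.e. ⟨∇E(φ(t)), h⟩ = DE(φ(t))[h] for all h ∈ V. Then the pseudo energy Ẽ(t) = E(φ(t)) + (α/(2M))·⟨T(ψ(t)), ψ(t)⟩ is differentiable with Ẽ'(t) = −(β/M)·⟨T(ψ(t)), ψ(t)⟩ ≤ 0 for all t; in particular Ẽ is nonincreasing. -/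
open scoped RealInnerProductSpace

theorem stmt_1 {V : Type*} [NormedAddCommGroup V] [InnerProductSpace ℝ V] [CompleteSpace V]
    (T : V →L[ℝ] V)
    (hTsym : ∀ x y : V, ⟪T x, y⟫ = ⟪x, T y⟫)
    (hTpsd : ∀ x : V, 0 ≤ ⟪T x, x⟫)
    (E : V → ℝ) (hE : Differentiable ℝ E)
    (M α β : ℝ) (hM : 0 < M) (hα : 0 ≤ α) (hβ : 0 ≤ β)
    (φ ψ : ℝ → V) (hφ : Differentiable ℝ φ) (hψdef : deriv φ = ψ)
    (hψ : Differentiable ℝ ψ)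
    (G : ℝ → V) (hG : ∀ (t : ℝ) (h : V), ⟪G t, h⟫ = fderiv ℝ E (φ t) h)
    (heq : ∀ t : ℝ, -(α / M) • T (deriv ψ t) - (β / M) • T (ψ t) = G t) :
    (∀ t : ℝ, HasDerivAt (fun s => E (φ s) + (α / (2 * M)) * ⟪T (ψ s), ψ s⟫)
      (-(β / M) * ⟪T (ψ t), ψ t⟫) t) ∧
    (∀ t : ℝ, -(β / M) * ⟪T (ψ t), ψ t⟫ ≤ 0) ∧
    Antitone (fun s => E (φ s) + (α / (2 * M)) * ⟪T (ψ s), ψ s⟫) := by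
  have hderiv : ∀ t : ℝ, HasDerivAt (fun s => E (φ s) + (α / (2 * M)) * ⟪T (ψ s), ψ s⟫)
      (-(β / M) * ⟪T (ψ t), ψ t⟫) t := by
    intro t
    have hφt : HasDerivAt φ (ψ t) t := hψdef ▸ (hφ t).hasDerivAt
    have hψt : HasDerivAt ψ (deriv ψ t) t := (hψ t).hasDerivAt
    have hEφ : HasDerivAt (fun s => E (φ s)) (fderiv ℝ E (φ t) (ψ t)) t :=
      (hE (φ t)).hasFDerivAt.comp_hasDerivAt t hφt
    have hTψ : HasDerivAt (fun s => T (ψ s)) (T (deriv ψ t)) t :=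
      T.hasFDerivAt.comp_hasDerivAt t hψt
    refine (hEφ.add ((hTψ.inner ℝ hψt).const_mul (α / (2 * M)))).congr_deriv ?_
    rw [← hG, ← heq, inner_sub_left, real_inner_smul_left, real_inner_smul_left,
      hTsym (ψ t) (deriv ψ t), real_inner_comm (T (deriv ψ t)) (ψ t)]
    field_simp
    ring
  have hnonpos : ∀ t : ℝ, -(β / M) * ⟪T (ψ t), ψ t⟫ ≤ 0 := fun t =>
    mul_nonpos_of_nonpos_of_nonneg (neg_nonpos.2 (div_nonneg hβ hM.le)) (hTpsd _)
  exact ⟨hderiv, hnonpos, antitone_of_hasDerivAt_nonpos hderiv hnonpos⟩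
end

section
/- Let V be a real Hilbert space, let A : V → V be a continuous symmetric linear map, let T : V → V be a continuous symmetric positive semidefinite linear map, and let M > 0, α ≥ 0, β ≥ 0 be real constants. Let H : ℝ → V be any function, let φ : ℝ → V be differentiable with ψ := φ' also differentiable, and let u : ℝ → ℝ be differentiable, such that for every t: −(α/M)·T(ψ'(t)) − (β/M)·T(ψ(t)) = A(A(φ(t))) + u(t)·H(t) and u'(t) = (1/2)·⟨H(t), φ'(t)⟩. Then the modified energy 𝓔(t) = (1/2)‖A(φ(t))‖² + (α/(2M))·⟨T(ψ(t)), ψ(t)⟩ + u(t)² is differentiable with 𝓔'(t) = −(β/M)·⟨T(ψ(t)), ψ(t)⟩ ≤ 0; in particular 𝓔 is nonincreasing. -/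
open scoped RealInnerProductSpace

theorem stmt_2 {V : Type*} [NormedAddCommGroup V] [InnerProductSpace ℝ V] [CompleteSpace V]
    (A : V →L[ℝ] V) (hAsym : ∀ x y : V, ⟪A x, y⟫ = ⟪x, A y⟫)
    (T : V →L[ℝ] V)
    (hTsym : ∀ x y : V, ⟪T x, y⟫ = ⟪x, T y⟫)
    (hTpsd : ∀ x : V, 0 ≤ ⟪T x, x⟫)
    (M α β : ℝ) (hM : 0 < M) (hα : 0 ≤ α) (hβ : 0 ≤ β)
    (H : ℝ → V)
    (φ ψ : ℝ → V) (hφ : Differentiable ℝ φ) (hψdef : deriv φ = ψ)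
    (hψ : Differentiable ℝ ψ)
    (u : ℝ → ℝ) (hu : Differentiable ℝ u)
    (heq : ∀ t : ℝ, -(α / M) • T (deriv ψ t) - (β / M) • T (ψ t)
      = A (A (φ t)) + u t • H t)
    (huode : ∀ t : ℝ, deriv u t = (1 / 2) * ⟪H t, deriv φ t⟫) :
    (∀ t : ℝ, HasDerivAt
      (fun s => (1 / 2) * ‖A (φ s)‖ ^ 2 + (α / (2 * M)) * ⟪T (ψ s), ψ s⟫ + (u s) ^ 2)
      (-(β / M) * ⟪T (ψ t), ψ t⟫) t) ∧
    (∀ t : ℝ, -(β / M) * ⟪T (ψ t), ψ t⟫ ≤ 0) ∧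
    Antitone (fun s => (1 / 2) * ‖A (φ s)‖ ^ 2 + (α / (2 * M)) * ⟪T (ψ s), ψ s⟫ + (u s) ^ 2) := by
  have hderiv : ∀ t : ℝ, HasDerivAt
      (fun s => (1 / 2) * ‖A (φ s)‖ ^ 2 + (α / (2 * M)) * ⟪T (ψ s), ψ s⟫ + (u s) ^ 2)
      (-(β / M) * ⟪T (ψ t), ψ t⟫) t := by
    intro t
    have hφt : HasDerivAt φ (ψ t) t := hψdef ▸ (hφ t).hasDerivAt
    have hψt : HasDerivAt ψ (deriv ψ t) t := (hψ t).hasDerivAt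
    have hut : HasDerivAt u ((1 / 2) * ⟪H t, ψ t⟫) t := by
      have h := (hu t).hasDerivAt
      rwa [huode, hψdef] at h
    have hAφ : HasDerivAt (fun s => A (φ s)) (A (ψ t)) t := A.hasFDerivAt.comp_hasDerivAt t hφt
    have hTψ : HasDerivAt (fun s => T (ψ s)) (T (deriv ψ t)) t :=
      T.hasFDerivAt.comp_hasDerivAt t hψt
    have henergy := ((hAφ.norm_sq.const_mul (1 / 2)).add
      ((hTψ.inner ℝ hψt).const_mul (α / (2 * M)))).add (hut.pow 2)
    have hpair := congrArg (fun x => ⟪x, ψ t⟫) (heq t)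
    simp only [inner_sub_left, inner_add_left, real_inner_smul_left, hAsym (A (φ t))] at hpair
    have hsymm : ⟪T (ψ t), deriv ψ t⟫ = ⟪T (deriv ψ t), ψ t⟫ := by
      rw [hTsym, real_inner_comm]
    refine henergy.congr_deriv ?_
    rw [hsymm]
    have hα2 : α / (2 * M) = α / M / 2 := by ring
    rw [hα2]
    push_cast
    linear_combination -hpair
  have hnonpos : ∀ t : ℝ, -(β / M) * ⟪T (ψ t), ψ t⟫ ≤ 0 := fun t =>
    mul_nonpos_of_nonpos_of_nonneg (neg_nonpos.mpr (div_nonneg hβ hM.le)) (hTpsd _)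
  exact ⟨hderiv, hnonpos, antitone_of_hasDerivAt_nonpos hderiv hnonpos⟩
end

section
/- Let V be a real inner product space, let A : V → V be a symmetric linear map, let T : V → V be a symmetric positive semidefinite linear map, and let M > 0, Δt > 0, α ≥ 0, β ≥ 0, S ≥ 0 be real constants. Suppose φ⁻, φ⁰, φ⁺, ψ⁰, ψ⁺, H ∈ V and u⁰, u⁺ ∈ ℝ satisfy: (i) −(α/(M·Δt))·T(ψ⁺ − ψ⁰) − (β/(2M))·T(ψ⁺ + ψ⁰) = A(A((φ⁺ + φ⁰)/2)) + ((u⁺ + u⁰)/2)·H + S·(φ⁺ − 2φ⁰ + φ⁻); (ii) (φ⁺ − φ⁰)/Δt = (ψ⁺ + ψ⁰)/2; (iii) u⁺ − u⁰ = (1/2)·⟨H, φ⁺ − φ⁰⟩. Then the exact energy identity holds: (1/2)‖A(φ⁺)‖² + (S/2)‖φ⁺ − φ⁰‖² + (u⁺)² + (α/(2M))·⟨T(ψ⁺), ψ⁺⟩ + (S/2)‖φ⁺ − 2φ⁰ + φ⁻‖² + (β·Δt/(4M))·⟨T(ψ⁺ + ψ⁰), ψ⁺ + ψ⁰⟩ =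 (1/2)‖A(φ⁰)‖² + (S/2)‖φ⁰ − φ⁻‖² + (u⁰)² + (α/(2M))·⟨T(ψ⁰), ψ⁰⟩. -/
open scoped RealInnerProductSpace

section EnergyPolarization

variable {V : Type*} [NormedAddCommGroup V] [InnerProductSpace ℝ V]

theorem inner_symmetric_sub_add {T : V →ₗ[ℝ] V} (hT : ∀ x y : V, ⟪T x, y⟫ = ⟪x, T y⟫) (x y : V) :
    ⟪T (x - y), x + y⟫ = ⟪T x, x⟫ - ⟪T y, y⟫ := by
  have h : ⟪T x, y⟫ = ⟪T y, x⟫ := by rw [hT, real_inner_comm]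
  simp only [map_sub, inner_sub_left, inner_add_right]
  linarith

theorem inner_symmetric_sq_add_sub {A : V →ₗ[ℝ] V} (hA : ∀ x y : V, ⟪A x, y⟫ = ⟪x, A y⟫)
    (x y : V) : ⟪A (A (x + y)), x - y⟫ = ‖A x‖ ^ 2 - ‖A y‖ ^ 2 := by
  rw [hA, map_add, map_sub, inner_add_left, inner_sub_right, inner_sub_right,
    real_inner_self_eq_norm_sq, real_inner_self_eq_norm_sq, real_inner_comm (A y) (A x)]
  ring

theorem two_mul_inner_sub_left (d e : V) :
    2 * ⟪d - e, d⟫ = ‖d‖ ^ 2 - ‖e‖ ^ 2 + ‖d - e‖ ^ 2 := by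
  rw [norm_sub_sq_real, inner_sub_left, real_inner_self_eq_norm_sq, real_inner_comm d e]
  ring

end EnergyPolarization

theorem stmt_5 {V : Type*} [NormedAddCommGroup V] [InnerProductSpace ℝ V]
    (A : V →ₗ[ℝ] V) (hAsym : ∀ x y : V, ⟪A x, y⟫ = ⟪x, A y⟫)
    (T : V →ₗ[ℝ] V)
    (hTsym : ∀ x y : V, ⟪T x, y⟫ = ⟪x, T y⟫)
    (hTpsd : ∀ x : V, 0 ≤ ⟪T x, x⟫)
    (M Δt α β S : ℝ) (hM : 0 < M) (hΔt : 0 < Δt) (hα : 0 ≤ α) (hβ : 0 ≤ β) (hS : 0 ≤ S)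
    (φm φ0 φp ψ0 ψp H : V) (u0 up : ℝ)
    (h1 : -(α / (M * Δt)) • T (ψp - ψ0) - (β / (2 * M)) • T (ψp + ψ0)
      = A (A (((1 : ℝ) / 2) • (φp + φ0))) + ((up + u0) / 2) • H + S • (φp - 2 • φ0 + φm))
    (h2 : (Δt)⁻¹ • (φp - φ0) = ((1 : ℝ) / 2) • (ψp + ψ0))
    (h3 : up - u0 = (1 / 2) * ⟪H, φp - φ0⟫) :
    (1 / 2) * ‖A φp‖ ^ 2 + (S / 2) * ‖φp - φ0‖ ^ 2 + up ^ 2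
      + (α / (2 * M)) * ⟪T ψp, ψp⟫
      + (S / 2) * ‖φp - 2 • φ0 + φm‖ ^ 2
      + (β * Δt / (4 * M)) * ⟪T (ψp + ψ0), ψp + ψ0⟫
    = (1 / 2) * ‖A φ0‖ ^ 2 + (S / 2) * ‖φ0 - φm‖ ^ 2 + u0 ^ 2
      + (α / (2 * M)) * ⟪T ψ0, ψ0⟫ := by
  have hd : φp - φ0 = (Δt / 2) • (ψp + ψ0) := by
    calc φp - φ0 = Δt • ((Δt)⁻¹ • (φp - φ0)) := by rw [smul_inv_smul₀ hΔt.ne']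
      _ = (Δt / 2) • (ψp + ψ0) := by rw [h2, smul_smul]; ring_nf
  have hdd : φp - 2 • φ0 + φm = (φp - φ0) - (φ0 - φm) := by
    rw [two_nsmul]; abel
  have hl : ⟪-(α / (M * Δt)) • T (ψp - ψ0) - (β / (2 * M)) • T (ψp + ψ0), φp - φ0⟫
      = -(α / (2 * M)) * (⟪T ψp, ψp⟫ - ⟪T ψ0, ψ0⟫)
        - (β * Δt / (4 * M)) * ⟪T (ψp + ψ0), ψp + ψ0⟫ := by
    rw [hd, inner_smul_right, inner_sub_left, real_inner_smul_left, real_inner_smul_left,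
      inner_symmetric_sub_add hTsym]
    field_simp
    ring
  rw [h1, hdd, map_smul, map_smul, inner_add_left, inner_add_left, real_inner_smul_left,
    real_inner_smul_left, real_inner_smul_left, inner_symmetric_sq_add_sub hAsym] at hl
  rw [hdd]
  linear_combination hl + (up + u0) * h3
    - (S / 2) * two_mul_inner_sub_left (φp - φ0) (φ0 - φm)
end

section
/- Let V be a real inner product space, let A : V → V be a symmetric linear map, let T : V → V be a symmetric positive semidefinite linear map, and let M > 0, Δt > 0, α ≥ 0, β ≥ 0, S ≥ 0 be real constants. Suppose φ⁻, φ⁰, φ⁺, ψ⁰, ψ⁺, H ∈ V and u⁰, u⁺ ∈ ℝ satisfy: (i) −(α/(M·Δt))·T(ψ⁺ − ψ⁰) − (β/(2M))·T(ψ⁺ + ψ⁰) = A(A((φ⁺ + φ⁰)/2)) + ((u⁺ + u⁰)/2)·H + S·(φ⁺ − 2φ⁰ + φ⁻); (ii) (φ⁺ − φ⁰)/Δt = (ψ⁺ + ψ⁰)/2; (iii) u⁺ − u⁰ = (1/2)·⟨H, φ⁺ − φ⁰⟩. Define the discrete energies E⁺ = (1/2)‖A(φ⁺)‖² + (S/2)‖φ⁺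 − φ⁰‖² + (u⁺)² + (α/(2M))·⟨T(ψ⁺), ψ⁺⟩ and E⁰ = (1/2)‖A(φ⁰)‖² + (S/2)‖φ⁰ − φ⁻‖² + (u⁰)² + (α/(2M))·⟨T(ψ⁰), ψ⁰⟩. Then E⁺ ≤ E⁰ − (β·Δt/(4M))·⟨T(ψ⁺ + ψ⁰), ψ⁺ + ψ⁰⟩; in particular E⁺ ≤ E⁰, i.e. the scheme is unconditionally energy stable. -/
open scoped RealInnerProductSpace

theorem stmt_6 {V : Type*} [NormedAddCommGroup V] [InnerProductSpace ℝ V]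
    (A : V →ₗ[ℝ] V) (hAsym : ∀ x y : V, ⟪A x, y⟫ = ⟪x, A y⟫)
    (T : V →ₗ[ℝ] V)
    (hTsym : ∀ x y : V, ⟪T x, y⟫ = ⟪x, T y⟫)
    (hTpsd : ∀ x : V, 0 ≤ ⟪T x, x⟫)
    (M Δt α β S : ℝ) (hM : 0 < M) (hΔt : 0 < Δt) (hα : 0 ≤ α) (hβ : 0 ≤ β) (hS : 0 ≤ S)
    (φm φ0 φp ψ0 ψp H : V) (u0 up : ℝ)
    (h1 : -(α / (M * Δt)) • T (ψp - ψ0) - (β / (2 * M)) • T (ψp + ψ0)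
      = A (A (((1 : ℝ) / 2) • (φp + φ0))) + ((up + u0) / 2) • H + S • (φp - 2 • φ0 + φm))
    (h2 : (Δt)⁻¹ • (φp - φ0) = ((1 : ℝ) / 2) • (ψp + ψ0))
    (h3 : up - u0 = (1 / 2) * ⟪H, φp - φ0⟫)
    (Ep E0 : ℝ)
    (hEp : Ep = (1 / 2) * ‖A φp‖ ^ 2 + (S / 2) * ‖φp - φ0‖ ^ 2 + up ^ 2
      + (α / (2 * M)) * ⟪T ψp, ψp⟫)
    (hE0 : E0 = (1 / 2) * ‖A φ0‖ ^ 2 + (S / 2) * ‖φ0 - φm‖ ^ 2 + u0 ^ 2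
      + (α / (2 * M)) * ⟪T ψ0, ψ0⟫) :
    Ep ≤ E0 - (β * Δt / (4 * M)) * ⟪T (ψp + ψ0), ψp + ψ0⟫ ∧ Ep ≤ E0 := by
  have hd : φp - φ0 = (Δt / 2) • (ψp + ψ0) := by
    have h := congrArg (Δt • ·) h2
    simp only [smul_smul, mul_inv_cancel₀ hΔt.ne', one_smul] at h
    rw [h]
    congr 1
    ring
  have hTdiff : ⟪T (ψp - ψ0), φp - φ0⟫ = Δt / 2 * (⟪T ψp, ψp⟫ - ⟪T ψ0, ψ0⟫) := by
    rw [hd, inner_smul_right, map_sub, inner_sub_left, inner_add_right, inner_add_right,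
      hTsym ψ0 ψp, real_inner_comm (T ψp) ψ0]
    ring
  have hTsum : ⟪T (ψp + ψ0), φp - φ0⟫ = Δt / 2 * ⟪T (ψp + ψ0), ψp + ψ0⟫ := by
    rw [hd, inner_smul_right]
  have hA : ⟪A (A (((1 : ℝ) / 2) • (φp + φ0))), φp - φ0⟫
      = 1 / 2 * (‖A φp‖ ^ 2 - ‖A φ0‖ ^ 2) := by
    rw [hAsym, map_smul, map_add, map_sub, real_inner_smul_left, inner_add_left, inner_sub_right,
      inner_sub_right, real_inner_self_eq_norm_sq, real_inner_self_eq_norm_sq,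
      real_inner_comm (A φp) (A φ0)]
    ring
  have hstab : ⟪φp - 2 • φ0 + φm, φp - φ0⟫
      = 1 / 2 * (‖φp - φ0‖ ^ 2 - ‖φ0 - φm‖ ^ 2 + ‖φp - 2 • φ0 + φm‖ ^ 2) := by
    have hsplit : φp - 2 • φ0 + φm = (φp - φ0) - (φ0 - φm) := by
      rw [two_smul]
      abel
    rw [hsplit, norm_sub_sq_real (φp - φ0), inner_sub_left (φp - φ0),
      real_inner_self_eq_norm_sq, real_inner_comm (φp - φ0) (φ0 - φm)]
    ring
  have hbalance := congrArg (fun v => ⟪v, φp - φ0⟫) h1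
  simp only [inner_sub_left (-(α / (M * Δt)) • T (ψp - ψ0)), inner_add_left,
    real_inner_smul_left, hTdiff, hTsum, hA, hstab] at hbalance
  have hα' : α / (M * Δt) * (Δt / 2 * (⟪T ψp, ψp⟫ - ⟪T ψ0, ψ0⟫))
      = α / (2 * M) * (⟪T ψp, ψp⟫ - ⟪T ψ0, ψ0⟫) := by
    field_simp
  have hβ' : β / (2 * M) * (Δt / 2 * ⟪T (ψp + ψ0), ψp + ψ0⟫)
      = β * Δt / (4 * M) * ⟪T (ψp + ψ0), ψp + ψ0⟫ := by
    field_simp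
    ring
  have hu : (up + u0) / 2 * ⟪H, φp - φ0⟫ = up ^ 2 - u0 ^ 2 := by
    linear_combination -(up + u0) * h3
  have hnumdiss : 0 ≤ S * ‖φp - 2 • φ0 + φm‖ ^ 2 := by positivity
  have hdiss : 0 ≤ β * Δt / (4 * M) * ⟪T (ψp + ψ0), ψp + ψ0⟫ :=
    mul_nonneg (by positivity) (hTpsd _)
  have hmain : Ep ≤ E0 - (β * Δt / (4 * M)) * ⟪T (ψp + ψ0), ψp + ψ0⟫ := by
    rw [hEp, hE0]
    linarith
  exact ⟨hmain, by linarith⟩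
end

section
/- Let Δt > 0, C > 0, M > 0, β ≥ 0 be real constants, let (q_n)_{n≥0} be a sequence of real numbers with q_n ≥ 0 for all n, and let (B_n)_{n≥0} be a sequence of real numbers with B_0 > 0 satisfying (B_{n+1} − B_n)/Δt = −(β·B_{n+1}/(C·M))·q_n for all n ≥ 0. Then for every n ≥ 0 one has B_{n+1} = B_n/(1 + (β·Δt/(C·M))·q_n), 0 < B_{n+1} ≤ B_n ≤ B_0, and C·ln(B_{n+1}) ≤ C·ln(B_n). -/
theorem stmt_8 (Δt C M β : ℝ) (hΔt : 0 < Δt) (hC : 0 < C) (hM : 0 < M) (hβ : 0 ≤ β)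
    (q : ℕ → ℝ) (hq : ∀ n : ℕ, 0 ≤ q n)
    (B : ℕ → ℝ) (hB0 : 0 < B 0)
    (hrec : ∀ n : ℕ, (B (n + 1) - B n) / Δt = -(β * B (n + 1) / (C * M)) * q n) :
    ∀ n : ℕ, B (n + 1) = B n / (1 + (β * Δt / (C * M)) * q n) ∧
      0 < B (n + 1) ∧ B (n + 1) ≤ B n ∧ B n ≤ B 0 ∧
      C * Real.log (B (n + 1)) ≤ C * Real.log (B n) := by
  have hdamp : ∀ n, 0 ≤ (β * Δt / (C * M)) * q n := fun n =>
    mul_nonneg (by positivity) (hq n)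
  have hstep : ∀ n, B (n + 1) = B n / (1 + (β * Δt / (C * M)) * q n) := by
    intro n
    have hne : 1 + (β * Δt / (C * M)) * q n ≠ 0 := by linarith [hdamp n]
    rw [eq_div_iff hne]
    have h := (div_eq_iff hΔt.ne').1 (hrec n)
    linear_combination h
  have hpos : ∀ n, 0 < B n := by
    intro n
    induction n with
    | zero => exact hB0
    | succ n ih =>
      rw [hstep n]
      exact div_pos ih (by linarith [hdamp n])
  have hle : ∀ n, B (n + 1) ≤ B n := by
    intro n
    rw [hstep n]
    exact div_le_self (hpos n).le (by linarith [hdamp n])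
  intro n
  exact ⟨hstep n, hpos (n + 1), hle n, antitone_nat_of_succ_le hle (Nat.zero_le n),
    mul_le_mul_of_nonneg_left (Real.log_le_log (hpos (n + 1)) (hle n)) hC.le⟩
end
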